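/- Let θ ∈ (0, π], T > 0, μ > 0 and α > 0. Then the infimum of the Keplerian action functional I_{μ,α,T} over the collision class Γ*_{T,θ} equals (3/2)·(μ·α²·π²·T)^{1/3}, i.e. inf { I_{μ,α,T}(r) : r ∈ Γ*_{T,θ} } = (3/2)(μα²π²T)^{1/3}. -/

import Mathlib

open Real MeasureTheory Set
open scoped ENNReal

noncomputable section

/-- Euclidean norm on `ℝ × ℝ`. -/
def enorm2 (v : ℝ × ℝ) : ℝ := Real.sqrt (v.1 ^ 2 + v.2 ^ 2)

/-- `H¹([0,T],ℝ²)`: absolutely continuous paths `[0,T] → ℝ²` with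
square-integrable derivative, recorded via an integrable (a.e.-)derivative `v`
together with the integral representation of `r`. -/
structure H1PathK (T : ℝ) where
  r : ℝ → ℝ × ℝ
  v : ℝ → ℝ × ℝ
  hvInt : IntegrableOn v (Icc (0:ℝ) T)
  hrep : ∀ t ∈ Icc (0:ℝ) T, r t = r 0 + ∫ s in (0:ℝ)..t, v s
  hL2 : IntegrableOn (fun t => enorm2 (v t) ^ 2) (Icc (0:ℝ) T)

/-- The Keplerian action functional `I_{μ,α,T}`, with value `+∞` allowed. -/
def keplerAction (mu alpha T : ℝ) (p : H1PathK T) : ℝ≥0∞ :=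
  ∫⁻ t in Icc (0:ℝ) T,
    (ENNReal.ofReal (mu/2 * enorm2 (p.v t) ^ 2)
      + ENNReal.ofReal alpha * (ENNReal.ofReal (enorm2 (p.r t)))⁻¹)

/-- Membership in `Γ_{T,θ}`: the endpoints span an angle `θ`, i.e.
`⟨r(0), r(T)⟩ = |r(0)|·|r(T)|·cos θ`. -/
def inGamma (T θ : ℝ) (p : H1PathK T) : Prop :=
  (p.r 0).1 * (p.r T).1 + (p.r 0).2 * (p.r T).2
    = enorm2 (p.r 0) * enorm2 (p.r T) * Real.cos θ

section LowerBound

open Filter Topology Interval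

theorem AbsolutelyContinuousOnInterval.of_dist_le {f g : ℝ → ℝ} {K a b : ℝ}
    (hg : AbsolutelyContinuousOnInterval g a b)
    (h : ∀ x ∈ uIcc a b, ∀ y ∈ uIcc a b, dist (f x) (f y) ≤ K * dist (g x) (g y)) :
    AbsolutelyContinuousOnInterval f a b := by
  unfold AbsolutelyContinuousOnInterval at hg ⊢
  have hK : Tendsto (fun E : ℕ × (ℕ → ℝ × ℝ) =>
      K * ∑ i ∈ Finset.range E.1, dist (g (E.2 i).1) (g (E.2 i).2))
      (AbsolutelyContinuousOnInterval.totalLengthFilter ⊓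
        𝓟 (AbsolutelyContinuousOnInterval.disjWithin a b)) (𝓝 0) := by
    have := Tendsto.const_mul K hg
    rwa [mul_zero] at this
  refine squeeze_zero' (Eventually.of_forall fun E => Finset.sum_nonneg fun _ _ => dist_nonneg)
    ?_ hK
  filter_upwards [mem_inf_of_right (mem_principal_self _)] with E hE
  rw [Finset.mul_sum]
  exact Finset.sum_le_sum fun i hi => h _ (hE.1 i hi).1 _ (hE.1 i hi).2

theorem enorm2_nonneg (v : ℝ × ℝ) : 0 ≤ enorm2 v := Real.sqrt_nonneg _

theorem enorm2_sq (v : ℝ × ℝ) : enorm2 v ^ 2 = v.1 ^ 2 + v.2 ^ 2 :=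
  Real.sq_sqrt (by positivity)

theorem enorm2_pos {v : ℝ × ℝ} (hv : v ≠ 0) : 0 < enorm2 v := by
  refine (enorm2_nonneg v).lt_of_ne' fun h => hv ?_
  have h2 := enorm2_sq v
  rw [h] at h2
  ext
  · simp only [Prod.fst_zero]; nlinarith [sq_nonneg v.1, sq_nonneg v.2]
  · simp only [Prod.snd_zero]; nlinarith [sq_nonneg v.1, sq_nonneg v.2]

theorem continuous_enorm2 : Continuous enorm2 := by
  unfold enorm2; fun_prop

theorem enorm2_eq_norm (v : ℝ × ℝ) : enorm2 v = ‖(⟨v.1, v.2⟩ : ℂ)‖ := by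
  rw [enorm2, Complex.norm_def, Complex.normSq_mk, sq, sq]

theorem abs_enorm2_sub_le (v w : ℝ × ℝ) :
    |enorm2 v - enorm2 w| ≤ |v.1 - w.1| + |v.2 - w.2| := by
  rw [enorm2_eq_norm, enorm2_eq_norm]
  refine (abs_norm_sub_norm_le _ _).trans ((Complex.norm_le_abs_re_add_abs_im _).trans ?_)
  simp

theorem HasDerivAt.enorm2 {r : ℝ → ℝ × ℝ} {v : ℝ × ℝ} {t : ℝ} (h : HasDerivAt r v t)
    (h0 : r t ≠ 0) :
    ∃ d, HasDerivAt (fun s => enorm2 (r s)) d t ∧ |d| ≤ _root_.enorm2 v := by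
  have hpos := enorm2_pos h0
  have hne : (r t).1 ^ 2 + (r t).2 ^ 2 ≠ 0 := by rw [← enorm2_sq]; positivity
  have h1 : HasDerivAt (fun s => (r s).1) v.1 t := h.fst
  have h2 : HasDerivAt (fun s => (r s).2) v.2 t := h.snd
  refine ⟨_, ((h1.pow 2).add (h2.pow 2)).sqrt hne, ?_⟩
  have hs : √(((fun s => (r s).1) ^ 2 + (fun s => (r s).2) ^ 2) t) = _root_.enorm2 (r t) := rfl
  rw [hs, abs_div, abs_of_pos (by positivity : (0:ℝ) < 2 * _root_.enorm2 (r t)),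
    div_le_iff₀ (by positivity)]
  refine abs_le_of_sq_le_sq ?_ (mul_nonneg (enorm2_nonneg _) (by positivity))
  rw [mul_pow, mul_pow, enorm2_sq, enorm2_sq]
  norm_num
  nlinarith [sq_nonneg ((r t).1 * v.2 - (r t).2 * v.1)]

/-- Regularised at `0`, the speed (up to a constant factor) of a Keplerian ejection of apocentre
`b`. -/
def ejectionSpeed (ε b x : ℝ) : ℝ := √(1 / max x ε - 1 / b)

/-- The primitive of `ejectionSpeed`. -/
def ejectionAction (ε b x : ℝ) : ℝ := ∫ s in (0:ℝ)..x, ejectionSpeed ε b s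

theorem continuous_ejectionSpeed {ε b : ℝ} (hε : 0 < ε) : Continuous (ejectionSpeed ε b) := by
  unfold ejectionSpeed
  refine Real.continuous_sqrt.comp (Continuous.sub ?_ continuous_const)
  exact continuous_const.div (by fun_prop) fun x => (lt_max_of_lt_right hε).ne'

theorem hasDerivAt_ejectionAction {ε : ℝ} (b x : ℝ) (hε : 0 < ε) :
    HasDerivAt (ejectionAction ε b) (ejectionSpeed ε b x) x :=
  ((continuous_ejectionSpeed hε).integral_hasStrictDerivAt 0 x).hasDerivAt

theorem abs_ejectionAction_sub_le {ε b : ℝ} (hε : 0 < ε) (hb : 0 < b) (x y : ℝ) :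
    |ejectionAction ε b x - ejectionAction ε b y| ≤ √(1 / ε) * |x - y| := by
  have hi (a c : ℝ) : IntervalIntegrable (ejectionSpeed ε b) volume a c :=
    (continuous_ejectionSpeed hε).intervalIntegrable a c
  unfold ejectionAction
  rw [intervalIntegral.integral_interval_sub_left (hi _ _) (hi _ _), ← Real.norm_eq_abs]
  refine intervalIntegral.norm_integral_le_of_norm_le_const fun s _ => ?_
  rw [Real.norm_eq_abs, ejectionSpeed, abs_of_nonneg (Real.sqrt_nonneg _)]
  apply Real.sqrt_le_sqrt
  have h1 : 1 / max s ε ≤ 1 / ε := one_div_le_one_div_of_le hε (le_max_right _ _)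
  have h2 : 0 < 1 / b := by positivity
  linarith

theorem hasDerivAt_cycloid_primitive {b x : ℝ} (hx : 0 < x) (hxb : x < b) :
    HasDerivAt (fun x => √b * arcsin √(x / b) + √(x * (1 - x / b))) √(1 / x - 1 / b) x := by
  have hb : 0 < b := hx.trans hxb
  have hq : 0 < x / b := by positivity
  have hq1 : x / b < 1 := (div_lt_one hb).2 hxb
  have hs1 : √(x / b) < 1 := by
    rw [Real.sqrt_lt' one_pos]; simpa using hq1
  have hs0 : 0 < √(x / b) := Real.sqrt_pos.2 hq
  have e1 : HasDerivAt (fun x : ℝ => x / b) (1 / b) x := (hasDerivAt_id x).div_const b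
  have hp : x * (1 - x / b) ≠ 0 := (mul_pos hx (by linarith)).ne'
  have d1 := ((Real.hasDerivAt_arcsin (by linarith) hs1.ne).comp x (e1.sqrt hq.ne')).const_mul √b
  have d2 := ((hasDerivAt_id x).mul (e1.const_sub 1)).sqrt hp
  convert! d1.add d2 using 1
  simp only [id, Pi.mul_apply]
  rw [Real.sq_sqrt hq.le, Real.sqrt_div hx.le, Real.sqrt_mul hx.le,
    show 1 / x - 1 / b = (1 - x / b) / x by field_simp, Real.sqrt_div (by linarith)]
  have hw : 0 < √(1 - x / b) := Real.sqrt_pos.2 (by linarith)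
  have hw2 : √(1 - x / b) ^ 2 = 1 - x / b := Real.sq_sqrt (by linarith)
  have hxs : 0 < √x := Real.sqrt_pos.2 hx
  have hbs : 0 < √b := Real.sqrt_pos.2 hb
  have hb2 : √b ^ 2 = b := Real.sq_sqrt hb.le
  generalize √(1 - x / b) = w at *
  generalize √x = y at *
  have hx' : x = b * (1 - w ^ 2) := by rw [hw2]; field_simp; ring
  have : x / b = 1 - w ^ 2 := by linarith
  rw [this]
  field_simp
  rw [hb2, hx']
  ring

theorem continuous_cycloid_primitive (b : ℝ) :
    Continuous (fun x => √b * arcsin √(x / b) + √(x * (1 - x / b))) := by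
  have := Real.continuous_arcsin
  fun_prop

theorem le_ejectionAction {ε b : ℝ} (hε : 0 < ε) (hb : ε < b) :
    √b * (π / 2) - (√b * arcsin √(ε / b) + √(ε * (1 - ε / b))) ≤ ejectionAction ε b b := by
  have hb0 : 0 < b := hε.trans hb
  have hi (a c : ℝ) : IntervalIntegrable (ejectionSpeed ε b) volume a c :=
    (continuous_ejectionSpeed hε).intervalIntegrable a c
  have h1 : ∫ x in ε..b, ejectionSpeed ε b x
      = √b * (π / 2) - (√b * arcsin √(ε / b) + √(ε * (1 - ε / b))) := by
    rw [intervalIntegral.integral_eq_sub_of_hasDerivAt_of_le hb.le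
      (continuous_cycloid_primitive b).continuousOn ?_ (hi _ _)]
    · simp [hb0.ne']
    · intro x hx
      rw [ejectionSpeed, max_eq_left hx.1.le]
      exact hasDerivAt_cycloid_primitive (hε.trans hx.1) hx.2
  rw [← h1, ejectionAction, ← intervalIntegral.integral_add_adjacent_intervals (hi 0 ε) (hi ε b)]
  have : 0 ≤ ∫ x in (0:ℝ)..ε, ejectionSpeed ε b x :=
    intervalIntegral.integral_nonneg hε.le fun x _ => Real.sqrt_nonneg _
  linarith

theorem kepler_lagrangian_ge {mu alpha ε b ρ V d : ℝ} (hmu : 0 < mu) (halpha : 0 < alpha)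
    (hρ : 0 < ρ) (hρb : ρ ≤ b) (hεb : ε ≤ b) (hd : |d| ≤ ejectionSpeed ε b ρ * V) :
    alpha / b + √(2 * mu * alpha) * |d| ≤ mu / 2 * V ^ 2 + alpha / ρ := by
  have hm : 0 < max ρ ε := lt_max_of_lt_left hρ
  have hs : ejectionSpeed ε b ρ ^ 2 ≤ 1 / ρ - 1 / b := by
    have h1 : 1 / b ≤ 1 / max ρ ε := one_div_le_one_div_of_le hm (max_le hρb hεb)
    have h2 : 1 / max ρ ε ≤ 1 / ρ := one_div_le_one_div_of_le hρ (le_max_left _ _)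
    rw [ejectionSpeed, Real.sq_sqrt (by linarith)]
    linarith
  set s := ejectionSpeed ε b ρ
  have hk2 : √(2 * mu * alpha) ^ 2 = 2 * mu * alpha := Real.sq_sqrt (by positivity)
  have hk := Real.sqrt_nonneg (2 * mu * alpha)
  have h3 := mul_le_mul_of_nonneg_left hd hk
  have h4 : √(2 * mu * alpha) * (s * V) ≤ mu / 2 * V ^ 2 + alpha * s ^ 2 := by
    have h5 : 0 ≤ (√(2 * mu * alpha) * s - mu * V) ^ 2 := sq_nonneg _
    have h6 : (√(2 * mu * alpha) * s - mu * V) ^ 2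
        = 2 * mu * (mu / 2 * V ^ 2 + alpha * s ^ 2 - √(2 * mu * alpha) * (s * V)) := by
      linear_combination s ^ 2 * hk2
    rw [h6] at h5
    have := nonneg_of_mul_nonneg_right h5 (by positivity)
    linarith
  have h7 := mul_le_mul_of_nonneg_left hs halpha.le
  have h8 : alpha * (1 / ρ - 1 / b) = alpha / ρ - alpha / b := by ring
  linarith

theorem kepler_amgm {mu alpha T b : ℝ} (hmu : 0 < mu) (halpha : 0 < alpha) (hT : 0 < T)
    (hb : 0 < b) :
    (3 / 2) * (mu * alpha ^ 2 * π ^ 2 * T) ^ ((1:ℝ) / 3)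
      ≤ alpha / b * T + √(2 * mu * alpha) * (√b * (π / 2)) := by
  have hpi := Real.pi_pos
  set K := (mu * alpha ^ 2 * π ^ 2 * T) ^ ((1:ℝ) / 3) with hK
  have hK3 : K ^ 3 = mu * alpha ^ 2 * π ^ 2 * T := by
    rw [hK, ← Real.rpow_natCast, ← Real.rpow_mul (by positivity)]
    norm_num
  have hk2 : √(2 * mu * alpha) ^ 2 = 2 * mu * alpha := Real.sq_sqrt (by positivity)
  have hb2 : √b ^ 2 = b := Real.sq_sqrt hb.le
  set p := alpha / b * T with hp
  set q := √(2 * mu * alpha) * √b * π / 4 with hq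
  have hp0 : 0 < p := by positivity
  have hq0 : 0 < q := by positivity
  have hpq : p * q ^ 2 = (K / 2) ^ 3 := by
    rw [div_pow K 2 3, hK3, hq, hp, div_pow, mul_pow, mul_pow, hk2, hb2]
    field_simp
    norm_num
  have h : 3 * (K / 2) ≤ p + 2 * q := by
    refine le_of_pow_le_pow_left₀ (n := 3) (by norm_num) (by positivity) ?_
    rw [mul_pow, ← hpq]
    nlinarith [mul_nonneg (sq_nonneg (p - q)) (by positivity : 0 ≤ p + 8 * q)]
  calc _ = 3 * (K / 2) := by ring
    _ ≤ p + 2 * q := h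
    _ = _ := by rw [hq]; ring

theorem H1PathK.intervalIntegrable_v {T : ℝ} (hT : 0 < T) (p : H1PathK T) :
    IntervalIntegrable p.v volume 0 T :=
  (intervalIntegrable_iff_integrableOn_Icc_of_le hT.le).2 p.hvInt

theorem H1PathK.continuousOn {T : ℝ} (hT : 0 < T) (p : H1PathK T) :
    ContinuousOn p.r (Icc 0 T) := by
  have h := intervalIntegral.continuousOn_primitive_interval
    (show IntegrableOn p.v (uIcc 0 T) by rw [uIcc_of_le hT.le]; exact p.hvInt)
  rw [uIcc_of_le hT.le] at h
  exact (continuousOn_const.add h).congr p.hrep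

theorem H1PathK.ae_hasDerivAt {T : ℝ} (hT : 0 < T) (p : H1PathK T) :
    ∀ᵐ t ∂volume.restrict (Icc 0 T), HasDerivAt p.r (p.v t) t := by
  rw [ae_restrict_iff' measurableSet_Icc]
  have h1 : ∀ᵐ x : ℝ, x ≠ 0 := by simp [ae_iff, measure_singleton]
  have h2 : ∀ᵐ x : ℝ, x ≠ T := by simp [ae_iff, measure_singleton]
  filter_upwards [(p.intervalIntegrable_v hT).ae_hasDerivAt_integral, h1, h2] with t ht h1 h2 htI
  rw [uIcc_of_le hT.le] at ht
  refine ((ht htI 0 (left_mem_Icc.2 hT.le)).const_add (p.r 0)).congr_of_eventuallyEq ?_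
  filter_upwards [Icc_mem_nhds (htI.1.lt_of_ne' h1) (htI.2.lt_of_ne h2)] with s hs
  exact p.hrep s hs

theorem H1PathK.abs_sub_le {T : ℝ} (hT : 0 < T) (p : H1PathK T) {x y : ℝ} (hx : x ∈ Icc 0 T)
    (hy : y ∈ Icc 0 T) :
    |enorm2 (p.r x) - enorm2 (p.r y)| ≤
      2 * |(∫ s in (0:ℝ)..x, ‖p.v s‖) - ∫ s in (0:ℝ)..y, ‖p.v s‖| := by
  have hi {z : ℝ} (hz : z ∈ Icc 0 T) : IntervalIntegrable p.v volume 0 z :=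
    (p.intervalIntegrable_v hT).mono_set (by
      rw [uIcc_of_le hT.le, uIcc_of_le hz.1]; exact Icc_subset_Icc_right hz.2)
  have hv : p.r x - p.r y = ∫ s in y..x, p.v s := by
    rw [p.hrep x hx, p.hrep y hy, add_sub_add_left_eq_sub,
      intervalIntegral.integral_interval_sub_left (hi hx) (hi hy)]
  have hn : ‖p.r x - p.r y‖ ≤ |∫ s in y..x, ‖p.v s‖| := by
    rw [hv]; exact intervalIntegral.norm_integral_le_abs_integral_norm
  rw [intervalIntegral.integral_interval_sub_left (hi hx).norm (hi hy).norm]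
  refine (abs_enorm2_sub_le _ _).trans ?_
  have h1 : |(p.r x).1 - (p.r y).1| ≤ ‖p.r x - p.r y‖ := norm_fst_le (p.r x - p.r y)
  have h2 : |(p.r x).2 - (p.r y).2| ≤ ‖p.r x - p.r y‖ := norm_snd_le (p.r x - p.r y)
  linarith

theorem H1PathK.absolutelyContinuous_ejectionAction {T ε b : ℝ} (hT : 0 < T) (p : H1PathK T)
    (hε : 0 < ε) (hb : 0 < b) :
    AbsolutelyContinuousOnInterval (fun t => ejectionAction ε b (enorm2 (p.r t))) 0 T := by
  refine ((p.intervalIntegrable_v hT).norm.absolutelyContinuousOnInterval_intervalIntegral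
    (c := 0) left_mem_uIcc).of_dist_le (K := √(1 / ε) * 2) fun x hx y hy => ?_
  rw [uIcc_of_le hT.le] at hx hy
  rw [Real.dist_eq, Real.dist_eq, mul_assoc]
  exact (abs_ejectionAction_sub_le hε hb _ _).trans
    (mul_le_mul_of_nonneg_left (p.abs_sub_le hT hx hy) (Real.sqrt_nonneg _))

theorem ofReal_le_keplerAction_of_lt {mu alpha T ε t₀ t₁ : ℝ} (hT : 0 < T) (hmu : 0 < mu)
    (halpha : 0 < alpha) (p : H1PathK T) (ht₀ : t₀ ∈ Icc 0 T) (h₀ : p.r t₀ = 0)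
    (ht₁ : t₁ ∈ Icc 0 T) (hmax : ∀ t ∈ Icc 0 T, enorm2 (p.r t) ≤ enorm2 (p.r t₁))
    (hε : 0 < ε) (hεb : ε < enorm2 (p.r t₁)) :
    ENNReal.ofReal (alpha / enorm2 (p.r t₁) * T + √(2 * mu * alpha) *
      ejectionAction ε (enorm2 (p.r t₁)) (enorm2 (p.r t₁))) ≤ keplerAction mu alpha T p := by
  set b := enorm2 (p.r t₁)
  have hb : 0 < b := hε.trans hεb
  set f : ℝ → ℝ := fun t => ejectionAction ε b (enorm2 (p.r t)) with hf
  have hac : AbsolutelyContinuousOnInterval f 0 T := p.absolutelyContinuous_ejectionAction hT hε hb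
  have hint : IntegrableOn (deriv f) (Icc 0 T) :=
    (intervalIntegrable_iff_integrableOn_Icc_of_le hT.le).1 hac.intervalIntegrable_deriv
  have hle : ejectionAction ε b b ≤ ∫ t in Icc 0 T, |deriv f t| := by
    have h1 : ∫ t in t₀..t₁, deriv f t = f t₁ - f t₀ :=
      (hac.mono (uIcc_subset_uIcc (by rwa [uIcc_of_le hT.le])
        (by rwa [uIcc_of_le hT.le]))).integral_deriv_eq_sub
    have h2 : f t₀ = 0 := by simp [hf, h₀, enorm2, ejectionAction]
    calc ejectionAction ε b b = ∫ t in t₀..t₁, deriv f t := by rw [h1, h2, sub_zero]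
      _ ≤ ‖∫ t in t₀..t₁, deriv f t‖ := le_abs_self _
      _ ≤ ∫ t in Ι t₀ t₁, ‖deriv f t‖ := intervalIntegral.norm_integral_le_integral_norm_uIoc
      _ ≤ ∫ t in Icc 0 T, |deriv f t| := by
        refine setIntegral_mono_set hint.norm (Eventually.of_forall fun _ => abs_nonneg _)
          (LE.le.eventuallyLE ?_)
        exact uIoc_subset_uIcc.trans (uIcc_subset_Icc ht₀ ht₁)
  have hlag : ∀ᵐ t ∂volume.restrict (Icc 0 T),
      ENNReal.ofReal (alpha / b + √(2 * mu * alpha) * |deriv f t|) ≤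
        ENNReal.ofReal (mu/2 * enorm2 (p.v t) ^ 2)
          + ENNReal.ofReal alpha * (ENNReal.ofReal (enorm2 (p.r t)))⁻¹ := by
    filter_upwards [p.ae_hasDerivAt hT, ae_restrict_mem measurableSet_Icc] with t ht htI
    by_cases h0 : p.r t = 0
    · simp [h0, enorm2, halpha]
    have hρ := enorm2_pos h0
    obtain ⟨d, hd, hdv⟩ := ht.enorm2 h0
    have hfd : deriv f t = ejectionSpeed ε b (enorm2 (p.r t)) * d :=
      ((hasDerivAt_ejectionAction b _ hε).comp t hd).deriv
    rw [← ENNReal.ofReal_inv_of_pos hρ, ← ENNReal.ofReal_mul halpha.le,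
      ← ENNReal.ofReal_add (by positivity) (by positivity)]
    refine ENNReal.ofReal_le_ofReal
      (kepler_lagrangian_ge hmu halpha hρ (hmax t htI) hεb.le ?_)
    rw [hfd, abs_mul, abs_of_nonneg (show 0 ≤ ejectionSpeed ε b _ from Real.sqrt_nonneg _)]
    exact mul_le_mul_of_nonneg_left hdv (Real.sqrt_nonneg _)
  have hic : Integrable (fun _ : ℝ => alpha / b) (volume.restrict (Icc 0 T)) :=
    integrableOn_const (by simp)
  have hid : Integrable (fun t => √(2 * mu * alpha) * |deriv f t|) (volume.restrict (Icc 0 T)) :=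
    Integrable.const_mul hint.norm _
  have hi2 : Integrable (fun t => alpha / b + √(2 * mu * alpha) * |deriv f t|)
      (volume.restrict (Icc 0 T)) := hic.add hid
  refine le_trans ?_ (lintegral_mono_ae hlag)
  rw [← ofReal_integral_eq_lintegral_ofReal hi2 (Eventually.of_forall fun t => by positivity)]
  refine ENNReal.ofReal_le_ofReal ?_
  rw [integral_add hic hid, integral_const_mul]
  have hc : ∫ _ in Icc 0 T, alpha / b = alpha / b * T := by
    simp [hT.le, mul_comm]
  rw [hc]
  have := mul_le_mul_of_nonneg_left hle (Real.sqrt_nonneg (2 * mu * alpha))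
  linarith

theorem ofReal_le_keplerAction {mu alpha T t₀ : ℝ} (hT : 0 < T) (hmu : 0 < mu)
    (halpha : 0 < alpha) (p : H1PathK T) (ht₀ : t₀ ∈ Icc 0 T) (h₀ : p.r t₀ = 0) :
    ENNReal.ofReal ((3/2) * (mu * alpha^2 * π^2 * T) ^ ((1:ℝ)/3)) ≤ keplerAction mu alpha T p := by
  obtain ⟨t₁, ht₁, hmax⟩ := isCompact_Icc.exists_isMaxOn ⟨t₀, ht₀⟩
    (continuous_enorm2.comp_continuousOn (p.continuousOn hT))
  replace hmax : ∀ t ∈ Icc 0 T, enorm2 (p.r t) ≤ enorm2 (p.r t₁) := fun t ht => hmax ht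
  rcases (enorm2_nonneg (p.r t₁)).eq_or_lt with hb | hb
  · have htop : keplerAction mu alpha T p = ⊤ := by
      rw [keplerAction, setLIntegral_congr_fun (g := fun _ => ⊤) measurableSet_Icc]
      · simp [hT]
      · intro t ht
        have h0 : enorm2 (p.r t) = 0 := le_antisymm ((hmax t ht).trans hb.symm.le) (enorm2_nonneg _)
        simp [h0, halpha]
    rw [htop]
    exact le_top
  set b := enorm2 (p.r t₁)
  refine (ENNReal.ofReal_le_ofReal (kepler_amgm hmu halpha hT hb)).trans ?_
  have hlim : Tendsto (fun ε => ENNReal.ofReal (alpha / b * T + √(2 * mu * alpha) *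
      (√b * (π / 2) - (√b * arcsin √(ε / b) + √(ε * (1 - ε / b)))))) (𝓝[>] 0)
      (𝓝 (ENNReal.ofReal (alpha / b * T + √(2 * mu * alpha) * (√b * (π / 2))))) := by
    have hc : Continuous (fun ε => ENNReal.ofReal (alpha / b * T + √(2 * mu * alpha) *
        (√b * (π / 2) - (√b * arcsin √(ε / b) + √(ε * (1 - ε / b)))))) :=
      ENNReal.continuous_ofReal.comp (continuous_const.add (continuous_const.mul
        (continuous_const.sub (continuous_cycloid_primitive b))))
    have := (hc.tendsto 0).mono_left (nhdsWithin_le_nhds (s := Ioi 0))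
    simpa using this
  refine le_of_tendsto hlim ?_
  filter_upwards [Ioo_mem_nhdsGT hb] with ε hε
  refine le_trans (ENNReal.ofReal_le_ofReal ?_)
    (ofReal_le_keplerAction_of_lt hT hmu halpha p ht₀ h₀ ht₁ hmax hε.1 hε.2)
  have := mul_le_mul_of_nonneg_left (le_ejectionAction hε.1 hε.2) (Real.sqrt_nonneg (2 * mu * alpha))
  linarith

end LowerBound

section Cycloid

/-- The time along a cycloidal ejection from the origin which comes to rest at time `T`, as a
function of the eccentric anomaly. -/
def cycloidTime (T η : ℝ) : ℝ := T / π * (η - sin η)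

theorem hasDerivAt_cycloidTime (T η : ℝ) :
    HasDerivAt (cycloidTime T) (T / π * (1 - cos η)) η :=
  ((hasDerivAt_id η).sub (Real.hasDerivAt_sin η)).const_mul _

theorem cos_lt_one_of_mem_Ioc {η : ℝ} (h : η ∈ Ioc 0 π) : cos η < 1 := by
  rw [← Real.cos_zero]
  exact Real.cos_lt_cos_of_nonneg_of_le_pi le_rfl h.2 h.1

theorem strictMonoOn_cycloidTime {T : ℝ} (hT : 0 < T) :
    StrictMonoOn (cycloidTime T) (Icc 0 π) := by
  refine strictMonoOn_of_deriv_pos (convex_Icc _ _)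
    (fun x _ => (hasDerivAt_cycloidTime T x).continuousAt.continuousWithinAt) fun x hx => ?_
  rw [interior_Icc] at hx
  rw [(hasDerivAt_cycloidTime T x).deriv]
  have := cos_lt_one_of_mem_Ioc ⟨hx.1, hx.2.le⟩
  have := Real.pi_pos
  exact mul_pos (by positivity) (by linarith)

theorem cycloidTime_zero (T : ℝ) : cycloidTime T 0 = 0 := by simp [cycloidTime]

theorem cycloidTime_pi (T : ℝ) : cycloidTime T π = T := by
  simp [cycloidTime, Real.pi_ne_zero]

theorem image_cycloidTime {T x : ℝ} (hT : 0 < T) (hx : x ∈ Icc 0 π) :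
    cycloidTime T '' Icc 0 x = Icc 0 (cycloidTime T x) := by
  have hm := (strictMonoOn_cycloidTime hT).monotoneOn
  apply Subset.antisymm
  · rintro _ ⟨y, hy, rfl⟩
    have hyI : y ∈ Icc 0 π := ⟨hy.1, hy.2.trans hx.2⟩
    exact ⟨by simpa [cycloidTime_zero] using hm (left_mem_Icc.2 Real.pi_pos.le) hyI hy.1,
      hm hyI hx hy.2⟩
  · have := intermediate_value_Icc hx.1 (f := cycloidTime T)
      fun y _ => (hasDerivAt_cycloidTime T y).continuousAt.continuousWithinAt
    rwa [cycloidTime_zero] at this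

/-- The inverse of `cycloidTime`. -/
def cycloidParam (T : ℝ) : ℝ → ℝ := Function.invFunOn (cycloidTime T) (Icc 0 π)

theorem cycloidParam_cycloidTime {T η : ℝ} (hT : 0 < T) (hη : η ∈ Icc 0 π) :
    cycloidParam T (cycloidTime T η) = η :=
  (strictMonoOn_cycloidTime hT).injOn.leftInvOn_invFunOn hη

theorem exists_cycloidTime_eq {T t : ℝ} (hT : 0 < T) (ht : t ∈ Icc 0 T) :
    ∃ η ∈ Icc 0 π, cycloidTime T η = t := by
  have := image_cycloidTime hT (right_mem_Icc.2 Real.pi_pos.le)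
  rw [cycloidTime_pi] at this
  rwa [← this] at ht

/-- The distance to the origin along the cycloidal ejection of apocentre `R`. -/
def cycloidRadius (T R t : ℝ) : ℝ := R / 2 * (1 - cos (cycloidParam T t))

/-- The speed along the cycloidal ejection of apocentre `R`. -/
def cycloidSpeed (T R t : ℝ) : ℝ :=
  R / 2 * sin (cycloidParam T t) / (T / π * (1 - cos (cycloidParam T t)))

theorem abs_cycloidTime_deriv {T : ℝ} (hT : 0 < T) (η : ℝ) :
    |T / π * (1 - cos η)| = T / π * (1 - cos η) :=
  abs_of_nonneg (mul_nonneg (by have := Real.pi_pos; positivity)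
    (by linarith [Real.cos_le_one η]))

theorem jacobian_mul_cycloidSpeed {T η : ℝ} (R : ℝ) (hT : 0 < T) (hη : η ∈ Icc 0 π) :
    |T / π * (1 - cos η)| • cycloidSpeed T R (cycloidTime T η) = R / 2 * sin η := by
  rw [abs_cycloidTime_deriv hT, cycloidSpeed, cycloidParam_cycloidTime hT hη, smul_eq_mul]
  rcases hη.1.eq_or_lt with h | h
  · simp [← h]
  · have := cos_lt_one_of_mem_Ioc ⟨h, hη.2⟩
    have h1 : 1 - cos η ≠ 0 := by linarith
    have := Real.pi_ne_zero
    field_simp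

theorem jacobian_mul_cycloidSpeed_sq {T η : ℝ} (R : ℝ) (hT : 0 < T) (hη : η ∈ Ioc 0 π) :
    |T / π * (1 - cos η)| • cycloidSpeed T R (cycloidTime T η) ^ 2
      = R ^ 2 * π / (4 * T) * (1 + cos η) := by
  have := cos_lt_one_of_mem_Ioc hη
  have h1 : 1 - cos η ≠ 0 := by linarith
  have := Real.pi_ne_zero
  rw [abs_cycloidTime_deriv hT, cycloidSpeed, cycloidParam_cycloidTime hT ⟨hη.1.le, hη.2⟩,
    smul_eq_mul, div_pow, mul_pow, mul_pow, Real.sin_sq]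
  field_simp
  ring

theorem injOn_cycloidTime {T x : ℝ} (hT : 0 < T) (hx : x ∈ Icc 0 π) : InjOn (cycloidTime T) (Icc 0 x) :=
  (strictMonoOn_cycloidTime hT).injOn.mono (Icc_subset_Icc_right hx.2)

theorem integrableOn_cycloidSpeed {T : ℝ} (R : ℝ) (hT : 0 < T) :
    IntegrableOn (cycloidSpeed T R) (Icc 0 T) := by
  have hpi : π ∈ Icc 0 π := right_mem_Icc.2 Real.pi_pos.le
  have him := image_cycloidTime hT hpi
  rw [cycloidTime_pi] at him
  rw [← him, integrableOn_image_iff_integrableOn_abs_deriv_smul measurableSet_Icc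
    (fun η _ => (hasDerivAt_cycloidTime T η).hasDerivWithinAt) (injOn_cycloidTime hT hpi),
    integrableOn_congr_fun (fun η hη => jacobian_mul_cycloidSpeed R hT hη) measurableSet_Icc]
  exact Continuous.integrableOn_Icc (by fun_prop)

theorem integrableOn_cycloidSpeed_sq {T : ℝ} (R : ℝ) (hT : 0 < T) :
    IntegrableOn (fun t => cycloidSpeed T R t ^ 2) (Icc 0 T) := by
  have hpi : π ∈ Icc 0 π := right_mem_Icc.2 Real.pi_pos.le
  have him := image_cycloidTime hT hpi
  rw [cycloidTime_pi] at him
  rw [← him, integrableOn_image_iff_integrableOn_abs_deriv_smul measurableSet_Icc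
    (fun η _ => (hasDerivAt_cycloidTime T η).hasDerivWithinAt) (injOn_cycloidTime hT hpi),
    integrableOn_Icc_iff_integrableOn_Ioc,
    integrableOn_congr_fun (fun η hη => jacobian_mul_cycloidSpeed_sq R hT hη) measurableSet_Ioc]
  exact Continuous.integrableOn_Ioc (by fun_prop)

theorem integral_cycloidSpeed {T t : ℝ} (R : ℝ) (hT : 0 < T) (ht : t ∈ Icc 0 T) :
    ∫ s in (0:ℝ)..t, cycloidSpeed T R s = cycloidRadius T R t := by
  obtain ⟨x, hx, rfl⟩ := exists_cycloidTime_eq hT ht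
  rw [intervalIntegral.integral_of_le ht.1, ← integral_Icc_eq_integral_Ioc,
    ← image_cycloidTime hT hx, integral_image_eq_integral_abs_deriv_smul measurableSet_Icc
    (fun η _ => (hasDerivAt_cycloidTime T η).hasDerivWithinAt) (injOn_cycloidTime hT hx),
    setIntegral_congr_fun measurableSet_Icc
      (fun η hη => jacobian_mul_cycloidSpeed R hT ⟨hη.1, hη.2.trans hx.2⟩),
    integral_Icc_eq_integral_Ioc, ← intervalIntegral.integral_of_le hx.1,
    intervalIntegral.integral_const_mul, integral_sin, cycloidRadius,
    cycloidParam_cycloidTime hT hx, Real.cos_zero]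

theorem cycloidRadius_zero (R : ℝ) {T : ℝ} (hT : 0 < T) : cycloidRadius T R 0 = 0 := by
  have := cycloidParam_cycloidTime hT (left_mem_Icc.2 Real.pi_pos.le)
  rw [cycloidTime_zero] at this
  simp [cycloidRadius, this]

theorem enorm2_mk_zero (x : ℝ) : enorm2 (x, 0) = |x| := by
  simp [enorm2, Real.sqrt_sq_eq_abs]

/-- The cycloidal ejection of apocentre `R` along a fixed ray. -/
def cycloidPath (R : ℝ) {T : ℝ} (hT : 0 < T) : H1PathK T where
  r t := (cycloidRadius T R t, 0)
  v t := (cycloidSpeed T R t, 0)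
  hvInt := (integrableOn_cycloidSpeed R hT).prodMk (integrable_zero _ _ _)
  hrep t ht := by
    have hi : IntegrableOn (cycloidSpeed T R) (Ioc 0 t) :=
      (integrableOn_cycloidSpeed R hT).mono_set
        (Ioc_subset_Icc_self.trans (Icc_subset_Icc_right ht.2))
    rw [cycloidRadius_zero R hT, ← integral_cycloidSpeed R hT ht,
      intervalIntegral.integral_of_le ht.1, intervalIntegral.integral_of_le ht.1,
      integral_pair hi (integrable_zero _ _ _)]
    simp
  hL2 := by
    simp only [enorm2_mk_zero, sq_abs]
    exact integrableOn_cycloidSpeed_sq R hT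

theorem keplerAction_cycloidPath {mu alpha T R : ℝ} (hT : 0 < T) (hmu : 0 < mu)
    (halpha : 0 < alpha) (hR : 0 < R) :
    keplerAction mu alpha T (cycloidPath R hT)
      = ENNReal.ofReal (mu * R ^ 2 * π ^ 2 / (8 * T) + 2 * alpha * T / R) := by
  have hpi : π ∈ Icc 0 π := right_mem_Icc.2 Real.pi_pos.le
  have hpi0 := Real.pi_pos
  have him := image_cycloidTime hT hpi
  rw [cycloidTime_pi] at him
  rw [keplerAction, ← him, lintegral_image_eq_lintegral_abs_deriv_mul measurableSet_Icc
    (fun η _ => (hasDerivAt_cycloidTime T η).hasDerivWithinAt) (injOn_cycloidTime hT hpi),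
    ← restrict_Ioc_eq_restrict_Icc,
    setLIntegral_congr_fun (g := fun η => ENNReal.ofReal
      (mu * R ^ 2 * π / (8 * T) * (1 + cos η) + 2 * alpha * T / (π * R))) measurableSet_Ioc]
  · rw [← ofReal_integral_eq_lintegral_ofReal (Continuous.integrableOn_Ioc (by fun_prop)) ?_,
      ← intervalIntegral.integral_of_le hpi0.le, intervalIntegral.integral_add
        (Continuous.intervalIntegrable (by fun_prop) _ _) (by simp),
      intervalIntegral.integral_const_mul, intervalIntegral.integral_add (by simp)
        (Real.continuous_cos.intervalIntegrable _ _)]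
    · congr 1
      simp
      field_simp
    · refine Filter.Eventually.of_forall fun η => ?_
      have : 0 ≤ 1 + cos η := by linarith [Real.neg_one_le_cos η]
      simp only [Pi.zero_apply]
      positivity
  · intro η hη
    have hcos := cos_lt_one_of_mem_Ioc hη
    have h1 : 0 < 1 - cos η := by linarith
    have hrad : 0 < R / 2 * (1 - cos η) := by positivity
    have hsq := jacobian_mul_cycloidSpeed_sq R hT hη
    simp only [cycloidPath, enorm2_mk_zero, sq_abs]
    rw [cycloidRadius, cycloidParam_cycloidTime hT ⟨hη.1.le, hη.2⟩, abs_of_pos hrad,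
      ← ENNReal.ofReal_inv_of_pos hrad, ← ENNReal.ofReal_mul halpha.le,
      ← ENNReal.ofReal_add (by positivity) (by positivity), ← ENNReal.ofReal_mul (abs_nonneg _)]
    congr 1
    rw [smul_eq_mul] at hsq
    rw [mul_add, mul_left_comm, hsq, abs_cycloidTime_deriv hT]
    field_simp
    ring

theorem exists_keplerAction_eq {mu alpha T : ℝ} (hT : 0 < T) (hmu : 0 < mu)
    (halpha : 0 < alpha) :
    ∃ p : H1PathK T, p.r 0 = 0 ∧ keplerAction mu alpha T p
      = ENNReal.ofReal ((3/2) * (mu * alpha^2 * π^2 * T) ^ ((1:ℝ)/3)) := by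
  have hpi := Real.pi_pos
  set K := (mu * alpha ^ 2 * π ^ 2 * T) ^ ((1:ℝ) / 3) with hK
  have hK0 : 0 < K := by positivity
  have hK3 : K ^ 3 = mu * alpha ^ 2 * π ^ 2 * T := by
    rw [hK, ← Real.rpow_natCast, ← Real.rpow_mul (by positivity)]
    norm_num
  refine ⟨cycloidPath (2 * alpha * T / K) hT, ?_, ?_⟩
  · simp [cycloidPath, cycloidRadius_zero _ hT]
  · rw [keplerAction_cycloidPath hT hmu halpha (by positivity)]
    congr 1
    have : mu * (2 * alpha * T / K) ^ 2 * π ^ 2 / (8 * T) = K / 2 := by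
      field_simp
      linear_combination (-8) * hK3
    rw [this]
    field_simp
    ring

end Cycloid

/-- `inf { I_{μ,α,T}(r) : r ∈ Γ*_{T,θ} } = (3/2)(μα²π²T)^{1/3}`,
where `Γ*_{T,θ}` consists of the paths of `Γ_{T,θ}` passing through the origin. -/
theorem statement10 (θ T mu alpha : ℝ) (hθ0 : 0 < θ) (hθ1 : θ ≤ π)
    (hT : 0 < T) (hmu : 0 < mu) (halpha : 0 < alpha) :
    (⨅ (p : H1PathK T)
        (_ : inGamma T θ p ∧ ∃ t ∈ Icc (0:ℝ) T, p.r t = 0),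
        keplerAction mu alpha T p)
      = ENNReal.ofReal ((3/2) * (mu * alpha^2 * π^2 * T) ^ ((1:ℝ)/3)) := by
  apply le_antisymm
  · obtain ⟨p, hp0, hp⟩ := exists_keplerAction_eq hT hmu halpha
    refine (iInf₂_le p ⟨?_, 0, left_mem_Icc.2 hT.le, hp0⟩).trans hp.le
    simp [inGamma, hp0, enorm2]
  · refine le_iInf₂ fun p hp => ?_
    obtain ⟨-, t₀, ht₀, h₀⟩ := hp
    exact ofReal_le_keplerAction hT hmu halpha p ht₀ h₀

end
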